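/- Suppose m divides |C| and the agreement a : C → M is envy-free, credible, and Pareto-optimal. Then every resource x ∈ M has load n_x(a) = |C|/m. -/

import Mathlib

/-- The load of resource `x` under agreement `a`: the number of players choosing `x`. -/
def load {C M : Type*} [Fintype C] [DecidableEq M] (a : C → M) (x : M) : ℕ :=
  (Finset.univ.filter fun i => a i = x).card

/-- The loads of all resources add up to the number of players. -/
theorem sum_load {C M : Type*} [Fintype C] [Fintype M] [DecidableEq M] (a : C → M) :
    ∑ x : M, load a x = Fintype.card C :=
  (Finset.card_eq_sum_card_fiberwise fun i _ => Finset.mem_coe.mpr (Finset.mem_univ (a i))).symm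

/-- A resource with nonzero load is chosen by some player. -/
theorem exists_of_load_ne_zero {C M : Type*} [Fintype C] [DecidableEq M] {a : C → M} {x : M}
    (hx : load a x ≠ 0) : ∃ i, a i = x := by
  obtain ⟨i, hi⟩ := Finset.card_ne_zero.mp hx
  exact ⟨i, (Finset.mem_filter.mp hi).2⟩

/-- If `m ∣ |C|` and the agreement is envy-free, credible, and
Pareto-optimal, then every resource is chosen by exactly `|C|/m` players. -/
theorem envyFree_credible_pareto_imp_uniform_load
    {C M : Type*} [Fintype C] [Fintype M] [DecidableEq M] [Nonempty C] [Nonempty M]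
    (f : ℕ → ℚ)
    (hf_mono : ∀ k, f k < f (k + 1))
    (hf_conv : ∀ k, f (k + 1) - f k ≤ f (k + 2) - f (k + 1))
    (hdvd : Fintype.card M ∣ Fintype.card C)
    (a : C → M)
    (henvy : ∀ i j : C, f (load a (a i)) = f (load a (a j)))
    (hcred : ∀ (i : C) (x : M), f (load a (a i)) ≤ f (load a x + 1))
    (hpareto : ¬ ∃ a' : C → M,
        (∀ i : C, f (load a' (a' i)) ≤ f (load a (a i))) ∧
        (∃ j : C, f (load a' (a' j)) < f (load a (a j)))) :
    ∀ x : M, load a x = Fintype.card C / Fintype.card M := by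
  have hmono : StrictMono f := strictMono_nat_of_lt_succ hf_mono
  have hsum : ∑ x : M, load a x = Fintype.card C := sum_load a
  obtain ⟨i₀⟩ := ‹Nonempty C›
  have hused : ∀ x, load a x ≠ 0 → load a x = load a (a i₀) := by
    intro x hx
    obtain ⟨i, rfl⟩ := exists_of_load_ne_zero hx
    exact hmono.injective (henvy i i₀)
  have hle : ∀ x, load a (a i₀) ≤ load a x + 1 := fun x => hmono.le_iff_le.mp (hcred i₀ x)
  have hcard : Fintype.card M ≤ Fintype.card C :=
    Nat.le_of_dvd (Fintype.card_pos_iff.mpr ⟨i₀⟩) hdvd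
  have hne : ∀ x, load a x ≠ 0 := by
    intro x hx
    have hlt : ∑ y : M, load a y < ∑ _y : M, 1 := by
      refine Finset.sum_lt_sum (fun y _ => ?_) ⟨x, Finset.mem_univ x, by omega⟩
      have := hle x
      have := hused y
      omega
    simp only [Finset.sum_const, Finset.card_univ, smul_eq_mul, mul_one] at hlt
    omega
  intro x
  rw [← hsum, Finset.sum_congr rfl fun y _ => hused y (hne y), hused x (hne x)]
  simp [Nat.mul_div_cancel_left _ (Fintype.card_pos (α := M))]
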